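/- arXiv:2603.14795 — 2 statements merged into one kernel-verified Lean document; each statement's English description precedes it below -/
import Mathlib

section
/- Let N ≥ 2 be an integer and x : ℤ/Nℤ → ℂ a function. Then det(X_N) = i^{−(N−1)(3N−2)/2} · N^{−N/2} · ∏_{d | N} ∏_{χ} ( d · Σ_{t ∈ (ℤ/N_dℤ)^×} x̂_d(t)·χ(t) ), where for each positive divisor d of N the inner product runs over all Dirichlet characters χ modulo N_d = N/d. -/
/-- The semigroup matrix `X_N` attached to `x : ℤ/Nℤ → ℂ`:
its `(i,j)` entry is `x(ij mod N)`, `0 ≤ i,j ≤ N−1`. -/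
def XMat (N : ℕ) (x : ZMod N → ℂ) : Matrix (Fin N) (Fin N) ℂ :=
  Matrix.of fun i j => x (((i : ℕ) : ZMod N) * ((j : ℕ) : ZMod N))

/-- For a divisor `d` of `N` and `t ∈ ℤ/N_dℤ` (`N_d = N/d`),
`x̂_d(t) = Σ_{r=0}^{N_d−1} x(dr mod N)·exp(2πi·tr/N_d)`. -/
noncomputable def xhat (N d : ℕ) (x : ZMod N → ℂ) (t : ZMod (N / d)) : ℂ :=
  ∑ r ∈ Finset.range (N / d),
    x (((d * r : ℕ) : ZMod N)) *
      Complex.exp (2 * Real.pi * Complex.I * (ZMod.val t) * r / ((N / d : ℕ) : ℂ))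

/-- `∏_χ (c · Σ_{t ∈ (ℤ/nℤ)ˣ} g(t)·χ(t))`, the product running over all Dirichlet
characters `χ` modulo `n`.  (The value for `n = 0` is irrelevant and set to `1`.) -/
noncomputable def charProdAll (c : ℂ) : (n : ℕ) → (ZMod n → ℂ) → ℂ
  | 0, _ => 1
  | (n + 1), g =>
      ∏ χ : DirichletCharacter ℂ (n + 1),
        (c * ∑ t : (ZMod (n + 1))ˣ, g (t : ZMod (n + 1)) * χ (t : ZMod (n + 1)))

/-- The matrix of the discrete Fourier transform, with entries `exp(2πi·jk/N)`. -/
noncomputable def dftMatrix (N : ℕ) [NeZero N] : Matrix (Fin N) (Fin N) ℂ :=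
  Matrix.of fun j k => ZMod.stdAddChar (((j : ℕ) : ZMod N) * ((k : ℕ) : ZMod N))

theorem sum_zmod_eq_sum_range {M : Type*} [AddCommMonoid M] (N : ℕ) [NeZero N] (f : ZMod N → M) :
    ∑ j, f j = ∑ j ∈ Finset.range N, f (j : ZMod N) := by
  refine Finset.sum_nbij' ZMod.val (fun j : ℕ => (j : ZMod N)) ?_ ?_ ?_ ?_ ?_
  · intro a _
    simpa using ZMod.val_lt a
  · simp
  · simp
  · intro a ha
    exact ZMod.val_cast_of_lt (by simpa using ha)
  · simp

theorem sum_zmod_eq_sum_fin {M : Type*} [AddCommMonoid M] (N : ℕ) [NeZero N] (f : ZMod N → M) :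
    ∑ j, f j = ∑ j : Fin N, f ((j : ℕ) : ZMod N) := by
  rw [sum_zmod_eq_sum_range, Fin.sum_univ_eq_sum_range fun j : ℕ => f (j : ZMod N)]

theorem sum_range_of_periodic {R : Type*} [Semiring R] {N n d : ℕ} (h : N = n * d) (g : ℕ → R)
    (hg : ∀ j, g (j + n) = g j) :
    ∑ j ∈ Finset.range N, g j = d * ∑ j ∈ Finset.range n, g j := by
  subst h
  induction d with
  | zero => simp
  | succ d ih =>
    have hper : ∀ m j, g (n * m + j) = g j := by
      intro m j
      induction m with
      | zero => simp
      | succ m ihm => rw [← ihm, ← hg (n * m + j)]; congr 1; ring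
    rw [Nat.mul_succ, Finset.sum_range_add, ih]
    simp only [hper]
    push_cast
    rw [add_mul, one_mul]

theorem stdAddChar_natCast (N : ℕ) [NeZero N] (j : ℕ) :
    ZMod.stdAddChar (j : ZMod N) = Complex.exp (2 * Real.pi * Complex.I * j / N) := by
  simpa using ZMod.stdAddChar_coe (N := N) (j : ℤ)

theorem dftMatrix_eq_vandermonde (N : ℕ) [NeZero N] :
    dftMatrix N =
      Matrix.vandermonde fun j : Fin N => ZMod.stdAddChar (((j : ℕ) : ZMod N)) := by
  ext j k
  rw [dftMatrix, Matrix.of_apply, Matrix.vandermonde_apply, ← AddChar.map_nsmul_eq_pow,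
    nsmul_eq_mul, mul_comm]

theorem dftMatrix_mul_conjTranspose (N : ℕ) [NeZero N] :
    dftMatrix N * (dftMatrix N).conjTranspose = (N : ℂ) • 1 := by
  ext i k
  have h : ∀ j : ZMod N, ZMod.stdAddChar (((i : ℕ) : ZMod N) * j) *
      star (ZMod.stdAddChar (((k : ℕ) : ZMod N) * j)) =
      ZMod.stdAddChar (j * (((i : ℕ) : ZMod N) - ((k : ℕ) : ZMod N))) := by
    intro j
    rw [← starRingEnd_apply, ← AddChar.map_neg_eq_conj, ← AddChar.map_add_eq_mul]
    congr 1
    ring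
  simp only [Matrix.mul_apply, Matrix.conjTranspose_apply, dftMatrix, Matrix.of_apply]
  rw [← sum_zmod_eq_sum_fin N fun j => ZMod.stdAddChar (((i : ℕ) : ZMod N) * j) *
      star (ZMod.stdAddChar (((k : ℕ) : ZMod N) * j))]
  simp only [h]
  rw [AddChar.sum_mulShift _ (ZMod.isPrimitive_stdAddChar N), ZMod.card]
  simp only [sub_eq_zero, ZMod.natCast_eq_natCast_iff', Nat.mod_eq_of_lt i.2,
    Nat.mod_eq_of_lt k.2, ← Fin.ext_iff]
  rw [Matrix.smul_apply, Matrix.one_apply]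
  simp

theorem norm_det_dftMatrix (N : ℕ) [NeZero N] : ‖(dftMatrix N).det‖ = Real.sqrt N ^ N := by
  have h := congrArg Matrix.det (dftMatrix_mul_conjTranspose N)
  rw [Matrix.det_mul, Matrix.det_conjTranspose, Matrix.det_smul, Matrix.det_one, mul_one,
    Fintype.card_fin] at h
  have h2 := congrArg norm h
  rw [norm_mul, norm_star, norm_pow, Complex.norm_natCast] at h2
  rw [← pow_left_inj₀ (norm_nonneg _) (by positivity) two_ne_zero, sq, h2, ← pow_mul, mul_comm,
    pow_mul, Real.sq_sqrt (Nat.cast_nonneg N)]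

theorem stdAddChar_sub (N : ℕ) [NeZero N] (i j : ℕ) :
    ZMod.stdAddChar (j : ZMod N) - ZMod.stdAddChar (i : ZMod N) =
      Complex.exp (Real.pi * Complex.I * i / N) * Complex.exp (Real.pi * Complex.I * j / N) *
        Complex.I * ((2 * Real.sin (Real.pi * ((j : ℝ) - i) / N) : ℝ) : ℂ) := by
  rw [stdAddChar_natCast, stdAddChar_natCast]
  push_cast
  rw [Complex.sin]
  have e1 : Complex.exp (2 * Real.pi * Complex.I * j / N) =
      Complex.exp (Real.pi * Complex.I * j / N) * Complex.exp (Real.pi * Complex.I * j / N) := by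
    rw [← Complex.exp_add]; congr 1; ring
  have e2 : Complex.exp (2 * Real.pi * Complex.I * i / N) =
      Complex.exp (Real.pi * Complex.I * i / N) * Complex.exp (Real.pi * Complex.I * i / N) := by
    rw [← Complex.exp_add]; congr 1; ring
  have e3 : Complex.exp (Real.pi * (j - i) / N * Complex.I) =
      Complex.exp (Real.pi * Complex.I * j / N) / Complex.exp (Real.pi * Complex.I * i / N) := by
    rw [← Complex.exp_sub]; congr 1; ring
  have e4 : Complex.exp (-(Real.pi * (j - i) / N) * Complex.I) =
      Complex.exp (Real.pi * Complex.I * i / N) / Complex.exp (Real.pi * Complex.I * j / N) := by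
    rw [← Complex.exp_sub]; congr 1; ring
  rw [e1, e2, e3, e4]
  have h1 := Complex.exp_ne_zero (Real.pi * Complex.I * j / N)
  have h2 := Complex.exp_ne_zero (Real.pi * Complex.I * i / N)
  field_simp
  rw [Complex.I_sq]
  ring

theorem sum_fin_mul_two (N : ℕ) : (∑ i : Fin N, (i : ℕ)) * 2 = N * (N - 1) := by
  rw [Fin.sum_univ_eq_sum_range fun i => i, Finset.sum_range_id_mul_two]

theorem prod_prod_Ioi_I (N : ℕ) :
    ∏ i : Fin N, ∏ _j ∈ Finset.Ioi i, Complex.I = Complex.I ^ (N * (N - 1) / 2) := by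
  simp only [Finset.prod_const, Fin.card_Ioi]
  rw [Finset.prod_pow_eq_pow_sum, Fin.sum_univ_eq_sum_range fun i => N - 1 - i,
    Finset.sum_range_reflect (fun i => i), Finset.sum_range_id]

theorem prod_prod_Ioi_exp (N : ℕ) [NeZero N] :
    ∏ i : Fin N, ∏ j ∈ Finset.Ioi i, (Complex.exp (Real.pi * Complex.I * (i : ℕ) / N) *
      Complex.exp (Real.pi * Complex.I * (j : ℕ) / N)) = Complex.I ^ ((N - 1) ^ 2) := by
  have h := Finset.prod_prod_Ioi_mul_eq_prod_prod_off_diag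
    fun _ i : Fin N => Complex.exp (Real.pi * Complex.I * (i : ℕ) / N)
  rw [h]
  have hN : (N : ℂ) ≠ 0 := NeZero.ne _
  have hpos : 1 ≤ N := NeZero.one_le
  have hs : (∑ i : Fin N, ((i : ℕ) : ℂ)) = N * (N - 1) / 2 := by
    have := congrArg (Nat.cast : ℕ → ℂ) (sum_fin_mul_two N)
    push_cast [hpos] at this
    rw [← this]
    ring
  simp only [Finset.prod_const, Finset.card_compl, Fintype.card_fin, Finset.card_singleton]
  have harg : ((N - 1 : ℕ) : ℂ) * (Real.pi * Complex.I * (N * (N - 1) / 2) / N) =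
      ((N - 1) ^ 2 : ℕ) * (Real.pi / 2 * Complex.I) := by
    push_cast [hpos]
    field_simp
  rw [Finset.prod_pow, ← Complex.exp_sum, ← Finset.sum_div, ← Finset.mul_sum, hs,
    ← Complex.exp_nat_mul, harg, Complex.exp_nat_mul, Complex.exp_pi_div_two_mul_I]

theorem det_dftMatrix (N : ℕ) [NeZero N] :
    (dftMatrix N).det =
      Complex.I ^ ((N - 1) * (3 * N - 2) / 2) * (Real.sqrt N : ℂ) ^ N := by
  set R : ℝ := ∏ i : Fin N, ∏ j ∈ Finset.Ioi i,
    2 * Real.sin (Real.pi * (((j : ℕ) : ℝ) - (i : ℕ)) / N) with hR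
  have hexp : (N - 1) * (3 * N - 2) / 2 = (N - 1) ^ 2 + N * (N - 1) / 2 := by
    obtain ⟨m, rfl⟩ : ∃ m, N = m + 1 := ⟨N - 1, (Nat.succ_pred (NeZero.ne N)).symm⟩
    have : m * (3 * (m + 1) - 2) = (m + 1) * m + m ^ 2 * 2 := by
      rw [show 3 * (m + 1) - 2 = 3 * m + 1 by omega]; ring
    rw [Nat.add_sub_cancel, this, Nat.add_mul_div_right _ _ two_pos, add_comm]
  have hdet : (dftMatrix N).det = Complex.I ^ ((N - 1) * (3 * N - 2) / 2) * (R : ℂ) := by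
    rw [dftMatrix_eq_vandermonde, Matrix.det_vandermonde]
    have hphase := prod_prod_Ioi_exp N
    simp only [Finset.prod_mul_distrib] at hphase
    simp only [stdAddChar_sub, Finset.prod_mul_distrib]
    rw [hphase, prod_prod_Ioi_I, hexp, pow_add, hR]
    simp only [Complex.ofReal_prod]
  have hpos : 0 ≤ R := by
    refine Finset.prod_nonneg fun i _ => Finset.prod_nonneg fun j hj => ?_
    have hij : ((i : ℕ) : ℝ) < (j : ℕ) := by exact_mod_cast Finset.mem_Ioi.1 hj
    have hj : ((j : ℕ) : ℝ) < N := by exact_mod_cast j.2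
    have hi : (0 : ℝ) ≤ (i : ℕ) := Nat.cast_nonneg _
    have hN : (0 : ℝ) < N := by linarith
    refine mul_nonneg zero_le_two (Real.sin_nonneg_of_nonneg_of_le_pi ?_ ?_)
    · have : (0 : ℝ) ≤ (j : ℕ) - (i : ℕ) := by linarith
      positivity
    · rw [div_le_iff₀ hN]
      exact mul_le_mul_of_nonneg_left (by linarith) Real.pi_pos.le
  have hn := norm_det_dftMatrix N
  rw [hdet, norm_mul, norm_pow, Complex.norm_I, one_pow, one_mul, Complex.norm_real,
    Real.norm_of_nonneg hpos] at hn
  rw [hdet, hn]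
  push_cast
  rfl

theorem det_group_matrix_eq_prod (n : ℕ) [NeZero n] (f : (ZMod n)ˣ → ℂ) :
    (Matrix.of fun u v : (ZMod n)ˣ => f (u⁻¹ * v)).det =
      ∏ χ : DirichletCharacter ℂ n, ∑ t : (ZMod n)ˣ, f t * χ (t : ZMod n) := by
  have hcard : Fintype.card (ZMod n)ˣ = Fintype.card (DirichletCharacter ℂ n) := by
    rw [ZMod.card_units_eq_totient, ← Nat.card_eq_fintype_card,
      DirichletCharacter.card_eq_totient_of_hasEnoughRootsOfUnity]
  obtain ⟨e⟩ := Fintype.card_eq.1 hcard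
  set A : Matrix (ZMod n)ˣ (ZMod n)ˣ ℂ := Matrix.of fun u v => f (u⁻¹ * v) with hA
  set C : Matrix (ZMod n)ˣ (ZMod n)ˣ ℂ := Matrix.of fun v w => e w (v : ZMod n) with hC
  set s : (ZMod n)ˣ → ℂ := fun w => ∑ t : (ZMod n)ˣ, f t * e w (t : ZMod n) with hs
  have hmul : A * C = C * Matrix.diagonal s := by
    ext u w
    rw [Matrix.mul_diagonal, Matrix.mul_apply, hs, Finset.mul_sum,
      ← Equiv.sum_comp (Equiv.mulLeft u)]
    refine Finset.sum_congr rfl fun t _ => ?_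
    simp only [hA, hC, Matrix.of_apply, Equiv.coe_mulLeft, inv_mul_cancel_left, Units.val_mul,
      map_mul]
    ring
  have hunit : IsUnit C := by
    rw [← Matrix.linearIndependent_cols_iff_isUnit]
    have hinj : Function.Injective fun w : (ZMod n)ˣ =>
        (Units.coeHom ℂ).comp (MulChar.equivToUnitHom (e w)) := by
      intro w w' h
      refine e.injective (MulChar.equivToUnitHom.injective (MonoidHom.ext fun v => Units.ext ?_))
      exact DFunLike.congr_fun h v
    have h := (linearIndependent_monoidHom (ZMod n)ˣ ℂ).comp _ hinj
    have hcol : C.col = (fun φ : (ZMod n)ˣ →* ℂ => ⇑φ) ∘ fun w =>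
        (Units.coeHom ℂ).comp (MulChar.equivToUnitHom (e w)) := rfl
    rw [hcol]
    exact h
  have hdet : C.det ≠ 0 := ((Matrix.isUnit_iff_isUnit_det C).1 hunit).ne_zero
  have h := congrArg Matrix.det hmul
  rw [Matrix.det_mul, Matrix.det_mul, mul_comm, Matrix.det_diagonal] at h
  rw [mul_left_cancel₀ hdet h]
  exact e.prod_comp fun χ : DirichletCharacter ℂ n => ∑ t : (ZMod n)ˣ, f t * χ (t : ZMod n)

theorem charProdAll_eq_det (c : ℂ) (n : ℕ) [NeZero n] (g : ZMod n → ℂ) :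
    charProdAll c n g =
      (Matrix.of fun u v : (ZMod n)ˣ => c * g ((u⁻¹ * v : (ZMod n)ˣ) : ZMod n)).det := by
  rw [det_group_matrix_eq_prod n fun t => c * g t]
  obtain ⟨m, rfl⟩ : ∃ m, n = m + 1 := ⟨n - 1, (Nat.succ_pred (NeZero.ne n)).symm⟩
  simp only [charProdAll, Finset.mul_sum, mul_assoc]

theorem XMat_mul_dftMatrix_apply (N : ℕ) [NeZero N] (x : ZMod N → ℂ) (i k : Fin N) :
    (XMat N x * dftMatrix N) i k =
      ∑ j : ZMod N, x (((i : ℕ) : ZMod N) * j) *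
        ZMod.stdAddChar (j * ((k : ℕ) : ZMod N)) := by
  rw [sum_zmod_eq_sum_fin]
  rfl

theorem XMat_mul_dftMatrix_apply_eq_zero (N : ℕ) [NeZero N] (x : ZMod N → ℂ) (i k : Fin N)
    (h : ¬ Nat.gcd i N ∣ k) : (XMat N x * dftMatrix N) i k = 0 := by
  rw [XMat_mul_dftMatrix_apply]
  obtain ⟨n, hn⟩ := Nat.gcd_dvd_right i N
  obtain ⟨a, ha⟩ := Nat.gcd_dvd_left i N
  set d := Nat.gcd i N
  have hd : d ≠ 0 := Nat.gcd_ne_zero_right (NeZero.ne N)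
  have hn0 : n ≠ 0 := by
    rintro rfl
    exact NeZero.ne N (by simpa using hn)
  have hin : ((i : ℕ) : ZMod N) * (n : ZMod N) = 0 := by
    rw [← Nat.cast_mul, ZMod.natCast_eq_zero_iff]
    exact ⟨a, by rw [ha, mul_right_comm, ← hn]⟩
  have hne : ZMod.stdAddChar ((n : ZMod N) * ((k : ℕ) : ZMod N)) ≠ (1 : ℂ) := by
    intro h1
    rw [← AddChar.map_zero_eq_one (ZMod.stdAddChar (N := N)),
      ZMod.injective_stdAddChar.eq_iff, ← Nat.cast_mul, ZMod.natCast_eq_zero_iff,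
      mul_comm n] at h1
    exact h (Nat.dvd_of_mul_dvd_mul_right (Nat.pos_of_ne_zero hn0) (hn ▸ h1))
  set S := ∑ j : ZMod N, x (((i : ℕ) : ZMod N) * j) *
    ZMod.stdAddChar (j * ((k : ℕ) : ZMod N)) with hS
  have hshift : S = S * ZMod.stdAddChar ((n : ZMod N) * ((k : ℕ) : ZMod N)) := by
    conv_lhs => rw [hS, ← Equiv.sum_comp (Equiv.addRight (n : ZMod N))]
    rw [hS, Finset.sum_mul]
    refine Finset.sum_congr rfl fun j _ => ?_
    rw [Equiv.coe_addRight, mul_add, hin, add_zero, add_mul, AddChar.map_add_eq_mul, mul_assoc]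
  by_contra h0
  exact hne (mul_left_cancel₀ h0 (by rw [← hshift, mul_one]))

theorem xhat_eq_sum (N d : ℕ) [NeZero (N / d)] (x : ZMod N → ℂ) (t : ZMod (N / d)) :
    xhat N d x t =
      ∑ r : ZMod (N / d), x ((d * r.val : ℕ) : ZMod N) * ZMod.stdAddChar (t * r) := by
  rw [sum_zmod_eq_sum_range, xhat]
  refine Finset.sum_congr rfl fun r hr => ?_
  rw [ZMod.val_cast_of_lt (Finset.mem_range.1 hr)]
  have htr : t * (r : ZMod (N / d)) = ((t.val * r : ℕ) : ZMod (N / d)) := by simp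
  rw [htr, stdAddChar_natCast]
  push_cast
  simp only [mul_assoc]

theorem stdAddChar_mul_of_dvd {N d : ℕ} [NeZero N] [NeZero (N / d)] (hd : d ∣ N) (a : ℕ) :
    ZMod.stdAddChar ((d * a : ℕ) : ZMod N) = ZMod.stdAddChar (a : ZMod (N / d)) := by
  rw [stdAddChar_natCast, stdAddChar_natCast]
  have hN : (N : ℂ) ≠ 0 := NeZero.ne _
  have hd0 : (d : ℂ) ≠ 0 := by
    rintro h
    rw [Nat.cast_eq_zero] at h
    exact NeZero.ne N (by simpa [h] using hd)
  rw [Nat.cast_div hd hd0]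
  congr 1
  push_cast
  field_simp

theorem natCast_mul_eq_of_natCast_eq {N d a b : ℕ} (hd : d ∣ N)
    (h : (a : ZMod (N / d)) = (b : ZMod (N / d))) :
    ((d * a : ℕ) : ZMod N) = ((d * b : ℕ) : ZMod N) := by
  rw [ZMod.natCast_eq_natCast_iff] at h ⊢
  have := h.mul_left' d
  rwa [Nat.mul_div_cancel' hd] at this

theorem sum_stdAddChar_eq_xhat {N d : ℕ} [NeZero N] [NeZero (N / d)] (hd : d ∣ N)
    (x : ZMod N → ℂ) (u v : (ZMod (N / d))ˣ) :
    ∑ j : ZMod N, x (((d * (u : ZMod (N / d)).val : ℕ) : ZMod N) * j) *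
        ZMod.stdAddChar (j * ((d * (v : ZMod (N / d)).val : ℕ) : ZMod N)) =
      d * xhat N d x ((u⁻¹ * v : (ZMod (N / d))ˣ) : ZMod (N / d)) := by
  set y : ZMod (N / d) → ℂ := fun r => x ((d * ((u : ZMod (N / d)) * r).val : ℕ) : ZMod N) *
    ZMod.stdAddChar (r * (v : ZMod (N / d))) with hy
  have hterm : ∀ j : ℕ, x (((d * (u : ZMod (N / d)).val : ℕ) : ZMod N) * (j : ZMod N)) *
      ZMod.stdAddChar ((j : ZMod N) * ((d * (v : ZMod (N / d)).val : ℕ) : ZMod N)) =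
      y (j : ZMod (N / d)) := by
    intro j
    have h1 : ((d * (u : ZMod (N / d)).val : ℕ) : ZMod N) * (j : ZMod N) =
        ((d * ((u : ZMod (N / d)) * (j : ZMod (N / d))).val : ℕ) : ZMod N) := by
      rw [← Nat.cast_mul, mul_assoc]
      exact natCast_mul_eq_of_natCast_eq hd (by simp)
    have h2 : (j : ZMod N) * ((d * (v : ZMod (N / d)).val : ℕ) : ZMod N) =
        ((d * (j * (v : ZMod (N / d)).val) : ℕ) : ZMod N) := by
      push_cast; ring
    rw [h1, h2, stdAddChar_mul_of_dvd hd, hy]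
    simp
  rw [sum_zmod_eq_sum_range, Finset.sum_congr rfl fun j _ => hterm j,
    sum_range_of_periodic (Nat.div_mul_cancel hd).symm (fun j => y (j : ZMod (N / d)))
      (fun j => by simp),
    ← sum_zmod_eq_sum_range, xhat_eq_sum]
  congr 1
  refine Fintype.sum_equiv (Units.mulLeft u) _ _ fun r => ?_
  have : ((u⁻¹ * v : (ZMod (N / d))ˣ) : ZMod (N / d)) * (u * r) = r * v := by
    rw [Units.val_mul, mul_mul_mul_comm, mul_comm (v : ZMod (N / d)), ← mul_assoc, Units.inv_mul,
      one_mul]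
  rw [Units.mulLeft_apply, this]

theorem gcd_mul_eq_mul_gcd_div {N d a : ℕ} (hd : d ∣ N) :
    Nat.gcd (d * a) N = d * Nat.gcd a (N / d) := by
  rw [← Nat.gcd_mul_left, Nat.mul_div_cancel' hd]

/-- The unit `u` modulo `N / d` corresponds to the index `d * u`. -/
noncomputable def unitsEquivGcdEq {N d : ℕ} [NeZero N] [NeZero (N / d)] (hd : d ∣ N) :
    (ZMod (N / d))ˣ ≃ {i : Fin N // Nat.gcd i N = d} :=
  Equiv.ofBijective
    (fun u => ⟨⟨d * (u : ZMod (N / d)).val, by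
        have hd0 : 0 < d := Nat.pos_of_dvd_of_pos hd (NeZero.pos N)
        calc d * (u : ZMod (N / d)).val < d * (N / d) :=
              Nat.mul_lt_mul_of_pos_left (ZMod.val_lt _) hd0
          _ = N := Nat.mul_div_cancel' hd⟩, by
        have h := ZMod.val_coe_unit_coprime u
        rw [gcd_mul_eq_mul_gcd_div hd, h.gcd_eq_one, mul_one]⟩)
    (by
      have hd0 : 0 < d := Nat.pos_of_dvd_of_pos hd (NeZero.pos N)
      constructor
      · intro u v h
        simp only [Subtype.mk.injEq, Fin.mk.injEq] at h
        exact Units.ext (ZMod.val_injective _ (Nat.eq_of_mul_eq_mul_left hd0 h))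
      · rintro ⟨i, hi⟩
        obtain ⟨a, ha⟩ : d ∣ i := hi ▸ Nat.gcd_dvd_left i N
        have hcop : a.Coprime (N / d) := by
          rw [ha, gcd_mul_eq_mul_gcd_div hd] at hi
          exact Nat.eq_of_mul_eq_mul_left hd0 (by rw [hi, mul_one])
        have hlt : a < N / d := by
          rw [Nat.lt_div_iff_mul_lt' hd, ← ha]
          exact i.2
        refine ⟨ZMod.unitOfCoprime a hcop, Subtype.ext (Fin.ext ?_)⟩
        simp only [ZMod.coe_unitOfCoprime, ZMod.val_cast_of_lt hlt, ha])

theorem det_toSquareBlock_eq_charProdAll (N d : ℕ) [NeZero N] (hd : d ∣ N) (x : ZMod N → ℂ) :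
    ((XMat N x * dftMatrix N).toSquareBlock (fun i : Fin N => Nat.gcd i N) d).det =
      charProdAll (d : ℂ) (N / d) (fun t => xhat N d x t) := by
  have : NeZero (N / d) := ⟨(Nat.div_pos (Nat.le_of_dvd (NeZero.pos N) hd)
    (Nat.pos_of_dvd_of_pos hd (NeZero.pos N))).ne'⟩
  rw [charProdAll_eq_det, ← Matrix.det_submatrix_equiv_self (unitsEquivGcdEq hd)]
  congr 1
  ext u v
  rw [Matrix.of_apply, ← sum_stdAddChar_eq_xhat hd]
  exact XMat_mul_dftMatrix_apply N x _ _

theorem image_gcd_eq_divisors (N : ℕ) [NeZero N] :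
    Finset.univ.image (fun i : Fin N => Nat.gcd i N) = N.divisors := by
  ext d
  simp only [Finset.mem_image, Finset.mem_univ, true_and, Nat.mem_divisors, NeZero.ne N, ne_eq,
    not_false_eq_true, and_true]
  constructor
  · rintro ⟨i, rfl⟩
    exact Nat.gcd_dvd_right _ _
  · intro hd
    refine ⟨⟨d % N, Nat.mod_lt _ (NeZero.pos N)⟩, ?_⟩
    exact (Nat.gcd_rec N d).symm.trans (Nat.gcd_eq_right hd)

theorem det_XMat_mul_dftMatrix (N : ℕ) [NeZero N] (x : ZMod N → ℂ) :
    (XMat N x * dftMatrix N).det =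
      ∏ d ∈ N.divisors, charProdAll (d : ℂ) (N / d) (fun t => xhat N d x t) := by
  have htri : (XMat N x * dftMatrix N).BlockTriangular fun i : Fin N => Nat.gcd i N := by
    intro i k hlt
    refine XMat_mul_dftMatrix_apply_eq_zero N x i k fun hdvd => hlt.not_ge ?_
    exact Nat.le_of_dvd (Nat.gcd_pos_of_pos_right _ (NeZero.pos N))
      (Nat.dvd_gcd hdvd (Nat.gcd_dvd_right _ _))
  rw [htri.det, image_gcd_eq_divisors]
  exact Finset.prod_congr rfl fun d hd =>
    det_toSquareBlock_eq_charProdAll N d (Nat.dvd_of_mem_divisors hd) x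

/-- `det(X_N) = i^{−(N−1)(3N−2)/2} · N^{−N/2} ·
∏_{d ∣ N} ∏_{χ mod N_d} (d · Σ_{t ∈ (ℤ/N_dℤ)ˣ} x̂_d(t)·χ(t))`. -/
theorem det_XMat (N : ℕ) (hN : 2 ≤ N) (x : ZMod N → ℂ) :
    (XMat N x).det =
      Complex.I ^ (-(((N - 1) * (3 * N - 2) / 2 : ℕ) : ℤ)) *
        ((Real.sqrt N : ℂ)) ^ (-(N : ℤ)) *
        ∏ d ∈ N.divisors, charProdAll (d : ℂ) (N / d) (fun t => xhat N d x t) := by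
  have : NeZero N := ⟨by omega⟩
  have hsqrt : (Real.sqrt N : ℂ) ≠ 0 := by
    rw [Complex.ofReal_ne_zero, Real.sqrt_ne_zero']
    exact_mod_cast NeZero.pos N
  have hI := Complex.I_ne_zero
  rw [← det_XMat_mul_dftMatrix, Matrix.det_mul, det_dftMatrix, zpow_neg, zpow_neg, zpow_natCast,
    zpow_natCast]
  field_simp
end

section
/- Let N ≥ 2 be an integer and z : ℤ/Nℤ → ℂ a function with z(−a) = −z(a) for all a. Then det(Z_N) = (−1)^{N⁻(N⁻−1)/2} · N^{−N⁻/2} · ∏_{d | N, N_d > 2} ∏_{χ odd} ( d · Σ_{t ∈ (ℤ/N_dℤ)^×} ẑ_d(t)·χ(t) ), where for each positive divisor d of N with N_d = N/d > 2 the inner product runs over all odd Dirichlet characters χ modulo N_d (those with χ(−1) = −1). -/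
/-- The matrix `Z_N` attached to an odd function `z : ℤ/Nℤ → ℂ`:
its `(i,j)` entry is `z(ij mod N)`, `1 ≤ i,j ≤ N⁻ = ⌊(N−1)/2⌋`. -/
def ZMat (N : ℕ) (z : ZMod N → ℂ) : Matrix (Fin ((N - 1) / 2)) (Fin ((N - 1) / 2)) ℂ :=
  Matrix.of fun i j => z ((((i : ℕ) + 1) : ZMod N) * (((j : ℕ) + 1) : ZMod N))

/-- `ẑ_d(t) = (1/2)·Σ_{r=1}^{N_d} z(dr mod N)·sin(2πtr/N_d)`, where `N_d = N/d`. -/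
noncomputable def zhat (N d : ℕ) (z : ZMod N → ℂ) (t : ZMod (N / d)) : ℂ :=
  (1 / 2 : ℂ) * ∑ r ∈ Finset.Icc 1 (N / d),
    z (((d * r : ℕ) : ZMod N)) *
      (Real.sin (2 * Real.pi * (ZMod.val t) * r / ((N / d : ℕ) : ℝ)) : ℝ)

open scoped Classical in
/-- `∏_{χ odd} (c · Σ_{t ∈ (ℤ/nℤ)ˣ} g(t)·χ(t))`, the product running over all odd
Dirichlet characters `χ` modulo `n` (those with `χ(−1) = −1`).
(The value for `n = 0` is irrelevant and set to `1`.) -/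
noncomputable def charProdOdd (c : ℂ) : (n : ℕ) → (ZMod n → ℂ) → ℂ
  | 0, _ => 1
  | (n + 1), g =>
      ∏ χ : DirichletCharacter ℂ (n + 1),
        if χ (-1) = -1 then
          (c * ∑ t : (ZMod (n + 1))ˣ, g (t : ZMod (n + 1)) * χ (t : ZMod (n + 1)))
        else 1

section

open Matrix Finset
open scoped ZMod

theorem sum_eq_two_mul_sum_of_halfSystem {I A : Type*} [Fintype I] [Fintype A] [InvolutiveNeg A]
    (ι : I → A) (hι : Function.Injective ι) (hneg : ∀ i j, ι i ≠ -ι j)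
    (hcov : ∀ a : A, a ≠ -a → ∃ i, a = ι i ∨ a = -ι i)
    (F : A → ℂ) (heven : ∀ a, F (-a) = F a) (hfix : ∀ a, a = -a → F a = 0) :
    ∑ a, F a = 2 * ∑ i, F (ι i) := by
  have hinj : Function.Injective (Sum.elim ι fun i => -ι i) := by
    rintro (i | i) (j | j) h
    · simpa using hι h
    · exact absurd h (hneg i j)
    · exact absurd h.symm (hneg j i)
    · simpa using hι (neg_injective h)
  rw [← Fintype.sum_of_injective _ hinj (fun x => F (Sum.elim ι (fun i => -ι i) x)) F ?_ fun _ => rfl]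
  · simp [heven, two_mul]
  · intro a ha
    by_contra hF
    obtain ⟨i, rfl | rfl⟩ := hcov a fun h => hF (hfix a h)
    · exact ha ⟨Sum.inl i, rfl⟩
    · exact ha ⟨Sum.inr i, rfl⟩

/-- The residues `1, …, ⌊(N-1)/2⌋`, a half system for the nonzero, non-2-torsion residues. -/
def halfRep (N : ℕ) (i : Fin ((N - 1) / 2)) : ZMod N := ((i : ℕ) + 1 : ℕ)

theorem halfRep_injective (N : ℕ) : Function.Injective (halfRep N) := by
  intro i j h
  have := i.2
  have := j.2
  rw [halfRep, halfRep, ZMod.natCast_eq_natCast_iff', Nat.mod_eq_of_lt (by omega),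
    Nat.mod_eq_of_lt (by omega)] at h
  exact Fin.ext (by omega)

theorem halfRep_ne_neg {N : ℕ} (i j : Fin ((N - 1) / 2)) : halfRep N i ≠ -halfRep N j := by
  intro h
  have := i.2
  have := j.2
  rw [eq_neg_iff_add_eq_zero, halfRep, halfRep, ← Nat.cast_add, ZMod.natCast_eq_zero_iff] at h
  have := Nat.le_of_dvd (by omega) h
  omega

theorem exists_halfRep {N : ℕ} [NeZero N] (a : ZMod N) (ha : a ≠ -a) :
    ∃ i, a = halfRep N i ∨ a = -halfRep N i := by
  have hlt := a.val_lt
  have h0 : a.val ≠ 0 := by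
    rw [Ne, ZMod.val_eq_zero]
    rintro rfl
    simp at ha
  have h2 : 2 * a.val ≠ N := by
    intro h
    apply ha
    rw [eq_neg_iff_add_eq_zero, ← two_mul]
    calc (2 * a : ZMod N) = ((2 * a.val : ℕ) : ZMod N) := by simp
      _ = 0 := by rw [h]; simp
  by_cases h : a.val ≤ (N - 1) / 2
  · refine ⟨⟨a.val - 1, by omega⟩, Or.inl ?_⟩
    simp only [halfRep]
    rw [Nat.sub_add_cancel (by omega)]
    simp
  · refine ⟨⟨N - a.val - 1, by omega⟩, Or.inr ?_⟩
    simp only [halfRep]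
    rw [Nat.sub_add_cancel (by omega), Nat.cast_sub hlt.le]
    simp

/-- The function `a ↦ sin (2πa/N)` on `ℤ/Nℤ`. -/
noncomputable def zmodSin (N : ℕ) [NeZero N] (a : ZMod N) : ℂ :=
  (ZMod.stdAddChar a - ZMod.stdAddChar (-a)) / (2 * Complex.I)

theorem stdAddChar_sub_neg {N : ℕ} [NeZero N] (a : ZMod N) :
    ZMod.stdAddChar a - ZMod.stdAddChar (-a) = 2 * Complex.I * zmodSin N a := by
  rw [zmodSin, mul_div_cancel₀]
  simp

theorem zmodSin_natCast {N : ℕ} [NeZero N] (k : ℕ) :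
    zmodSin N (k : ZMod N) = (Real.sin (2 * Real.pi * k / N) : ℝ) := by
  have h1 := ZMod.stdAddChar_coe (N := N) (k : ℤ)
  have h2 := ZMod.stdAddChar_coe (N := N) (-(k : ℤ))
  push_cast at h1 h2
  rw [zmodSin, h1, h2]
  push_cast
  rw [Complex.sin, mul_comm 2 Complex.I, ← div_div, Complex.div_I, ← neg_mul,
    show (2 * Real.pi * Complex.I * k / N : ℂ) = 2 * Real.pi * k / N * Complex.I by ring,
    show (2 * Real.pi * Complex.I * -k / N : ℂ) = -(2 * Real.pi * k / N) * Complex.I by ring]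
  ring

/-- The matrix `(sin (2πij/N))`, `1 ≤ i, j ≤ ⌊(N-1)/2⌋`. -/
noncomputable def sinMat (N : ℕ) [NeZero N] : Matrix (Fin ((N - 1) / 2)) (Fin ((N - 1) / 2)) ℂ :=
  Matrix.of fun i j => zmodSin N (halfRep N i * halfRep N j)

theorem sum_stdAddChar_mul {N : ℕ} [NeZero N] (b : ZMod N) :
    ∑ x : ZMod N, ZMod.stdAddChar (x * b) = if b = 0 then (N : ℂ) else 0 := by
  rw [AddChar.sum_mulShift b (ZMod.isPrimitive_stdAddChar N), ZMod.card]
  push_cast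
  rfl

theorem zmodSin_neg {N : ℕ} [NeZero N] (a : ZMod N) : zmodSin N (-a) = -zmodSin N a := by
  rw [zmodSin, zmodSin, neg_neg]
  ring

theorem sum_eq_two_mul_sum_halfRep {N : ℕ} [NeZero N] (F : ZMod N → ℂ)
    (heven : ∀ a, F (-a) = F a) (hfix : ∀ a, a = -a → F a = 0) :
    ∑ a, F a = 2 * ∑ i, F (halfRep N i) :=
  sum_eq_two_mul_sum_of_halfSystem _ (halfRep_injective N) halfRep_ne_neg exists_halfRep F heven hfix

theorem sinMat_mul_self (N : ℕ) [NeZero N] :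
    sinMat N * sinMat N = ((N : ℂ) / 4) • (1 : Matrix _ _ ℂ) := by
  ext i j
  have h0 (a : ZMod N) (h : a = -a) (b : ZMod N) : zmodSin N (a * b) = 0 := by
    have : zmodSin N (a * b) = -zmodSin N (a * b) := by
      conv_lhs => rw [h, neg_mul, zmodSin_neg]
    linear_combination this / 2
  have key := sum_eq_two_mul_sum_halfRep
    (fun a : ZMod N => zmodSin N (a * halfRep N i) * zmodSin N (a * halfRep N j))
    (fun a => by simp [neg_mul, zmodSin_neg]) (fun a h => by simp [h0 a h])
  have hne : halfRep N i + halfRep N j ≠ 0 := fun h => halfRep_ne_neg i j (eq_neg_of_add_eq_zero_left h)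
  have hfull : ∑ a : ZMod N, zmodSin N (a * halfRep N i) * zmodSin N (a * halfRep N j)
      = if i = j then (N : ℂ) / 2 else 0 := by
    have expand (a : ZMod N) : zmodSin N (a * halfRep N i) * zmodSin N (a * halfRep N j) =
        (-1 / 4 : ℂ) * (ZMod.stdAddChar (a * (halfRep N i + halfRep N j))
          - ZMod.stdAddChar (a * (halfRep N i - halfRep N j))
          - ZMod.stdAddChar (a * (halfRep N j - halfRep N i))
          + ZMod.stdAddChar (a * -(halfRep N i + halfRep N j))) := by
      have e1 : a * (halfRep N i + halfRep N j) = a * halfRep N i + a * halfRep N j := by ring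
      have e2 : a * (halfRep N i - halfRep N j) = a * halfRep N i + -(a * halfRep N j) := by ring
      have e3 : a * (halfRep N j - halfRep N i) = -(a * halfRep N i) + a * halfRep N j := by ring
      have e4 : a * -(halfRep N i + halfRep N j) = -(a * halfRep N i) + -(a * halfRep N j) := by
        ring
      rw [e1, e2, e3, e4]
      simp only [AddChar.map_add_eq_mul, zmodSin]
      field_simp
      rw [Complex.I_sq]
      ring
    simp only [expand]
    rw [← Finset.mul_sum, Finset.sum_add_distrib, Finset.sum_sub_distrib, Finset.sum_sub_distrib]
    simp only [sum_stdAddChar_mul, neg_eq_zero, hne, if_false, sub_eq_zero,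
      (halfRep_injective N).eq_iff]
    by_cases hij : i = j
    · simp [hij]; ring
    · simp [hij, Ne.symm hij]
  rw [Matrix.mul_apply, Matrix.smul_apply, Matrix.one_apply]
  rw [hfull] at key
  simp only [sinMat, Matrix.of_apply]
  simp only [mul_comm (halfRep N i)]
  split_ifs at key ⊢ with h
  · simp only [smul_eq_mul]; linear_combination -key / 2
  · simp only [smul_zero]; linear_combination -key / 2

open Polynomial in
theorem neg_one_pow_mul_det_sin_pos (n : ℕ) (θ : Fin n → ℝ) (hθ : StrictMono θ)
    (h0 : ∀ i, 0 < θ i) (hπ : ∀ i, θ i < Real.pi) :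
    0 < (-1 : ℝ) ^ (n * (n - 1) / 2) *
      (Matrix.of fun i j : Fin n => Real.sin (((j : ℕ) + 1) * θ i)).det := by
  let p : Fin n → ℝ[X] := fun j => C ((2 : ℝ) ^ (j : ℕ))⁻¹ * Chebyshev.U ℝ ((j : ℕ) : ℤ)
  have hp (j : Fin n) : ((2 : ℝ) ^ (j : ℕ))⁻¹ ≠ 0 := by positivity
  have hdet := Matrix.det_eval_matrixOfPolynomials_eq_det_vandermonde (fun i => Real.cos (θ i)) p
    (fun j => by rw [natDegree_C_mul (hp j), Chebyshev.natDegree_U_natCast])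
    (fun j => by
      rw [Monic, leadingCoeff_mul, leadingCoeff_C, Chebyshev.leadingCoeff_U_natCast]
      exact inv_mul_cancel₀ (by positivity))
  have hsin : (Matrix.of fun i j : Fin n => Real.sin (((j : ℕ) + 1) * θ i)).det =
      (∏ i, Real.sin (θ i)) * ((∏ j : Fin n, (2 : ℝ) ^ (j : ℕ)) *
        (Matrix.vandermonde fun i => Real.cos (θ i)).det) := by
    rw [hdet, ← Matrix.det_mul_row, ← Matrix.det_mul_column]
    congr 1
    ext i j
    have := Polynomial.Chebyshev.U_real_cos (θ i) ((j : ℕ) : ℤ)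
    push_cast at this
    simp only [Matrix.of_apply, p, eval_mul, eval_C]
    rw [mul_inv_cancel_left₀ (by positivity), mul_comm, mul_comm (Real.sin _), this, mul_comm]
  have hV : (-1 : ℝ) ^ (n * (n - 1) / 2) * (Matrix.vandermonde fun i => Real.cos (θ i)).det =
      ∏ i : Fin n, ∏ j ∈ Ioi i, (Real.cos (θ i) - Real.cos (θ j)) := by
    have hcard : n * (n - 1) / 2 = ∑ i : Fin n, (Ioi i).card := by
      simp only [Fin.card_Ioi]
      rw [Fin.sum_univ_eq_sum_range (fun i => n - 1 - i) n, Finset.sum_range_reflect (fun i => i),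
        Finset.sum_range_id]
    rw [Matrix.det_vandermonde, hcard, ← Finset.prod_pow_eq_pow_sum, ← Finset.prod_mul_distrib]
    refine Finset.prod_congr rfl fun i _ => ?_
    rw [← Finset.prod_const, ← Finset.prod_mul_distrib]
    exact Finset.prod_congr rfl fun j _ => by ring
  rw [hsin, show ∀ a b c d : ℝ, a * (b * (c * d)) = b * c * (a * d) by intros; ring, hV]
  have hs (i : Fin n) : 0 < Real.sin (θ i) := Real.sin_pos_of_pos_of_lt_pi (h0 i) (hπ i)
  refine mul_pos (mul_pos (Finset.prod_pos fun i _ => hs i)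
    (Finset.prod_pos fun i _ => by positivity)) (Finset.prod_pos fun i _ => Finset.prod_pos ?_)
  intro j hj
  have := Real.cos_lt_cos_of_nonneg_of_le_pi (h0 i).le (hπ j).le (hθ (Finset.mem_Ioi.mp hj))
  linarith

theorem det_sinMat (N : ℕ) [NeZero N] :
    (sinMat N).det = (-1 : ℂ) ^ ((N - 1) / 2 * ((N - 1) / 2 - 1) / 2) *
      ((Real.sqrt N : ℂ) / 2) ^ ((N - 1) / 2) := by
  set n := (N - 1) / 2 with hn
  have hNpos : (0 : ℝ) < N := Nat.cast_pos.mpr (NeZero.pos N)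
  let R : Matrix (Fin n) (Fin n) ℝ :=
    Matrix.of fun i j : Fin n => Real.sin (((j : ℕ) + 1) * (2 * Real.pi * ((i : ℕ) + 1) / N))
  have hSR : sinMat N = R.map Complex.ofRealHom := by
    ext i j
    simp only [sinMat, Matrix.of_apply, Matrix.map_apply, R, halfRep, ← Nat.cast_mul,
      zmodSin_natCast]
    push_cast
    simp only [Complex.ofRealHom_eq_coe, Complex.ofReal_sin]
    congr 1
    push_cast
    ring
  have hdetR : (sinMat N).det = (R.det : ℂ) := by
    rw [hSR]
    exact (RingHom.map_det Complex.ofRealHom R).symm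
  have hpos : 0 < (-1 : ℝ) ^ (n * (n - 1) / 2) * R.det := by
    refine neg_one_pow_mul_det_sin_pos n _ ?_ ?_ ?_
    · intro i j hij
      have : (i : ℝ) < (j : ℝ) := by exact_mod_cast hij
      dsimp only
      gcongr
    · intro i
      positivity
    · intro i
      have h := i.2
      have : 2 * ((i : ℕ) + 1) < N := by omega
      have : (2 : ℝ) * ((i : ℕ) + 1) < N := by exact_mod_cast this
      rw [div_lt_iff₀ hNpos]
      nlinarith [Real.pi_pos]
  have hsq : ((-1 : ℝ) ^ (n * (n - 1) / 2) * R.det) ^ 2 = ((Real.sqrt N / 2) ^ n) ^ 2 := by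
    have h := congrArg Matrix.det (sinMat_mul_self N)
    rw [Matrix.det_mul, Matrix.det_smul, Matrix.det_one, hdetR, Fintype.card_fin, mul_one] at h
    rw [← hn] at h
    have h' : R.det * R.det = ((N : ℝ) / 4) ^ n :=
      Complex.ofReal_injective (by push_cast; exact h)
    rw [mul_pow, ← pow_mul, mul_comm _ 2, pow_mul, neg_one_sq, one_pow, one_mul, sq, h', ← pow_mul,
      mul_comm n 2, pow_mul, div_pow _ _ 2, Real.sq_sqrt hNpos.le]
    norm_num
  have hroot := (pow_left_inj₀ hpos.le (by positivity) two_ne_zero).mp hsq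
  have hR : R.det = (-1 : ℝ) ^ (n * (n - 1) / 2) * (Real.sqrt N / 2) ^ n := by
    rw [← hroot, ← mul_assoc, ← mul_pow]
    simp
  rw [hdetR, hR]
  push_cast
  rfl

theorem sum_units_dirichletCharacter {m : ℕ} [NeZero m] (χ ψ : DirichletCharacter ℂ m) :
    ∑ g : (ZMod m)ˣ, (χ (g : ZMod m))⁻¹ * ψ (g : ZMod m) =
      if χ = ψ then (m.totient : ℂ) else 0 := by
  have h (g : (ZMod m)ˣ) : (χ (g : ZMod m))⁻¹ * ψ (g : ZMod m) = (χ⁻¹ * ψ) (g : ZMod m) := by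
    rw [MulChar.mul_apply, MulChar.inv_apply_eq_inv']
  simp only [h]
  have hs : ∑ g : (ZMod m)ˣ, (χ⁻¹ * ψ) (g : ZMod m) = ∑ a : ZMod m, (χ⁻¹ * ψ) a := by
    refine Fintype.sum_of_injective _ Units.val_injective _ _ (fun a ha => ?_) fun _ => rfl
    exact MulChar.map_nonunit _ fun ⟨u, hu⟩ => ha ⟨u, hu⟩
  rw [hs]
  split_ifs with hχ
  · subst hχ
    rw [inv_mul_cancel, MulChar.sum_one_eq_card_units, ZMod.card_units_eq_totient]
  · exact MulChar.sum_eq_zero_of_ne_one fun h => hχ (inv_mul_eq_one.mp h)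

open scoped Classical in
/-- Group determinant of an odd function on `(ℤ/mℤ)ˣ`, with respect to a half system. -/
theorem det_oddGroupMatrix {m : ℕ} [NeZero m] {I : Type*} [Fintype I] [DecidableEq I]
    (r : I → (ZMod m)ˣ) (hr : Function.Injective r) (hneg : ∀ i j, r i ≠ -r j)
    (hcov : ∀ a : (ZMod m)ˣ, ∃ i, a = r i ∨ a = -r i)
    (hm : ∀ a : (ZMod m)ˣ, a ≠ -a) (h : ZMod m → ℂ) (hodd : ∀ a, h (-a) = -h a) :
    (Matrix.of fun i k : I => h ((r k * (r i)⁻¹ : (ZMod m)ˣ) : ZMod m)).det =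
      ∏ χ : DirichletCharacter ℂ m, if χ (-1) = -1 then
        (1 / 2) * ∑ t : (ZMod m)ˣ, h (t : ZMod m) * χ (t : ZMod m) else 1 := by
  let O := {χ : DirichletCharacter ℂ m // χ (-1) = -1}
  have hχneg (χ : O) (a : ZMod m) : χ.1 (-a) = -χ.1 a := by
    have := map_mul χ.1 (-1) a
    rwa [χ.2, neg_one_mul, neg_one_mul] at this
  have hφ : (m.totient : ℂ) ≠ 0 := by
    exact_mod_cast (Nat.totient_pos.mpr (NeZero.pos m)).ne'
  have hsum (F : (ZMod m)ˣ → ℂ) (hF : ∀ a, F (-a) = F a) : ∑ a, F a = 2 * ∑ i, F (r i) :=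
    sum_eq_two_mul_sum_of_halfSystem r hr hneg (fun a _ => hcov a) F hF fun a ha => absurd ha (hm a)
  let X : Matrix I O ℂ := Matrix.of fun i χ => χ.1 (r i : ZMod m)
  let Y : Matrix O I ℂ := Matrix.of fun χ i => 2 / (m.totient : ℂ) * (χ.1 (r i : ZMod m))⁻¹
  let lam : O → ℂ := fun χ => (1 / 2) * ∑ t : (ZMod m)ˣ, h (t : ZMod m) * χ.1 (t : ZMod m)
  have hYX : Y * X = 1 := by
    ext χ ψ
    have h1 := hsum (fun g => (χ.1 (g : ZMod m))⁻¹ * ψ.1 (g : ZMod m)) fun a => by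
      rw [Units.val_neg, hχneg, hχneg, inv_neg, neg_mul_neg]
    rw [sum_units_dirichletCharacter] at h1
    simp only [Matrix.mul_apply, Matrix.one_apply, X, Y, Matrix.of_apply, mul_assoc,
      ← Finset.mul_sum]
    rw [div_mul_eq_mul_div, ← h1]
    by_cases hχ : χ = ψ
    · rw [if_pos (congrArg _ hχ), if_pos hχ, div_self hφ]
    · rw [if_neg fun hc => hχ (Subtype.ext hc), if_neg hχ, zero_div]
  have hXY : X * Y = 1 := by
    ext i j
    have h1 := DirichletCharacter.sum_char_inv_mul_char_eq ℂ (r j).isUnit (r i : ZMod m)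
    have h2 := DirichletCharacter.sum_char_inv_mul_char_eq ℂ (r j).isUnit (-r i : ZMod m)
    rw [← Units.val_neg, if_neg fun h => hneg j i (Units.ext h)] at h2
    simp only [Units.val_injective.eq_iff.trans hr.eq_iff] at h1
    have h3 : ∑ χ : O, χ.1 (r j : ZMod m)⁻¹ * χ.1 (r i : ZMod m) =
        (∑ χ : DirichletCharacter ℂ m, χ (r j : ZMod m)⁻¹ * χ (r i : ZMod m) -
        ∑ χ : DirichletCharacter ℂ m, χ (r j : ZMod m)⁻¹ * χ (-r i : (ZMod m)ˣ)) / 2 := by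
      rw [← Finset.sum_sub_distrib, Finset.sum_div]
      refine Fintype.sum_of_injective _ Subtype.val_injective _ _ (fun χ hχ => ?_) fun χ => ?_
      · have hodd' : χ (-1) = 1 := by
          rcases χ.even_or_odd with he | ho
          · exact he
          · exact absurd ⟨⟨χ, ho⟩, rfl⟩ hχ
        rw [Units.val_neg, ← neg_one_mul (r i : ZMod m), map_mul, hodd']
        ring
      · rw [Units.val_neg, hχneg]
        ring
    rw [h1, h2] at h3
    simp only [Matrix.mul_apply, Matrix.one_apply, X, Y, Matrix.of_apply]
    have h4 (χ : O) : χ.1 (r i : ZMod m) * (2 / (m.totient : ℂ) * (χ.1 (r j : ZMod m))⁻¹) =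
        2 / (m.totient : ℂ) * (χ.1 (r j : ZMod m)⁻¹ * χ.1 (r i : ZMod m)) := by
      rw [← MulChar.inv_apply_eq_inv', MulChar.inv_apply]
      rw [ZMod.inv_coe_unit, Ring.inverse_unit]
      ring
    simp only [h4]
    rw [← Finset.mul_sum, h3]
    by_cases hij : i = j
    · simp [hij, hφ]
    · simp [hij, Ne.symm hij]
  have hBX : (Matrix.of fun i k : I => h ((r k * (r i)⁻¹ : (ZMod m)ˣ) : ZMod m)) * X =
      X * Matrix.diagonal lam := by
    ext i χ
    rw [Matrix.mul_diagonal]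
    simp only [Matrix.mul_apply, X, Matrix.of_apply, lam]
    have h1 := hsum (fun g => h ((g * (r i)⁻¹ : (ZMod m)ˣ) : ZMod m) * χ.1 (g : ZMod m)) fun a => by
      rw [neg_mul, Units.val_neg, Units.val_neg, hχneg, hodd, neg_mul_neg]
    have h2 := Fintype.sum_equiv (Equiv.mulRight (r i)⁻¹)
      (fun g : (ZMod m)ˣ => h ((g * (r i)⁻¹ : (ZMod m)ˣ) : ZMod m) * χ.1 (g : ZMod m))
      (fun g => χ.1 (r i : ZMod m) * (h (g : ZMod m) * χ.1 (g : ZMod m))) fun g => by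
        rw [Equiv.coe_mulRight, mul_left_comm, ← map_mul, ← Units.val_mul, mul_comm (r i),
          inv_mul_cancel_right]
    rw [← Finset.mul_sum] at h2
    rw [h1] at h2
    linear_combination h2 / 2
  have hB : (Matrix.of fun i k : I => h ((r k * (r i)⁻¹ : (ZMod m)ˣ) : ZMod m)) =
      X * Matrix.diagonal lam * Y := by
    rw [← hBX, Matrix.mul_assoc, hXY, Matrix.mul_one]
  rw [hB, Matrix.det_conj_of_mul_eq_one hXY hYX, Matrix.det_diagonal]
  refine Fintype.prod_of_injective _ Subtype.val_injective _ _ (fun χ hχ => ?_) fun χ => ?_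
  · exact if_neg fun hc => hχ ⟨⟨χ, hc⟩, rfl⟩
  · rw [if_pos χ.2]

theorem sum_Icc_natCast {m : ℕ} [NeZero m] (g : ZMod m → ℂ) :
    ∑ r ∈ Finset.Icc 1 m, g (r : ZMod m) = ∑ x, g x := by
  refine Finset.sum_nbij (fun r : ℕ => (r : ZMod m)) (fun _ _ => Finset.mem_univ _) ?_ ?_
    fun _ _ => rfl
  · intro r hr s hs h
    simp only [Finset.coe_Icc, Set.mem_Icc] at hr hs
    have h := (ZMod.natCast_eq_natCast_iff _ _ _).mp h
    refine h.eq_of_abs_lt ?_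
    rw [abs_lt]
    constructor <;> omega
  · intro x _
    by_cases hx : x.val = 0
    · exact ⟨m, by simp [NeZero.one_le], by simp [(ZMod.val_eq_zero x).mp hx]⟩
    · have := x.val_lt
      exact ⟨x.val, by simp only [Finset.coe_Icc, Set.mem_Icc]; omega, by simp⟩

theorem I_mul_dft_of_odd {m : ℕ} [NeZero m] (y : ZMod m → ℂ) (hy : ∀ a, y (-a) = -y a)
    (u : ZMod m) :
    Complex.I * 𝓕 y u = ∑ r ∈ Finset.Icc 1 m, y (r : ZMod m) *
      (Real.sin (2 * Real.pi * (ZMod.val u) * r / (m : ℝ)) : ℝ) := by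
  have hsin (r : ℕ) : ((Real.sin (2 * Real.pi * (ZMod.val u) * r / (m : ℝ)) : ℝ) : ℂ) =
      zmodSin m (u * (r : ZMod m)) := by
    rw [← ZMod.natCast_zmod_val u, ← Nat.cast_mul, zmodSin_natCast, ZMod.natCast_zmod_val]
    push_cast
    ring_nf
  simp only [hsin]
  rw [sum_Icc_natCast fun x => y x * zmodSin m (u * x)]
  have h1 : 𝓕 y u = ∑ j, ZMod.stdAddChar (-(j * u)) * y j := ZMod.dft_apply y u
  have h2 : 𝓕 y u = -∑ j, ZMod.stdAddChar (j * u) * y j := by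
    rw [h1, ← Equiv.sum_comp (Equiv.neg (ZMod m)), ← Finset.sum_neg_distrib]
    exact Finset.sum_congr rfl fun j _ => by simp [hy]
  have h3 : ∑ x, y x * zmodSin m (u * x) = (2 * Complex.I)⁻¹ *
      (∑ j, ZMod.stdAddChar (j * u) * y j - ∑ j, ZMod.stdAddChar (-(j * u)) * y j) := by
    rw [← Finset.sum_sub_distrib, Finset.mul_sum]
    refine Finset.sum_congr rfl fun j _ => ?_
    rw [zmodSin, mul_comm u j]
    ring
  have h4 : ∑ j, ZMod.stdAddChar (j * u) * y j = -𝓕 y u := by rw [h2, neg_neg]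
  rw [h3, ← h1, h4]
  field_simp
  rw [Complex.I_sq]
  ring

theorem I_mul_dft_section {N d : ℕ} [NeZero (N / d)] (hd : d ∣ N) (z : ZMod N → ℂ)
    (hz : ∀ a, z (-a) = -z a) (u : ZMod (N / d)) :
    Complex.I * 𝓕 (fun x : ZMod (N / d) => z ((d * x.val : ℕ) : ZMod N)) u =
      2 * zhat N d z u := by
  have hdm : d * (N / d) = N := Nat.mul_div_cancel' hd
  have hcast (r : ℕ) : ((d * (r : ZMod (N / d)).val : ℕ) : ZMod N) = ((d * r : ℕ) : ZMod N) := by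
    rw [ZMod.natCast_eq_natCast_iff, ZMod.val_natCast]
    have := (Nat.mod_modEq r (N / d)).mul_left' d
    rwa [hdm] at this
  rw [I_mul_dft_of_odd]
  · simp only [hcast, zhat]
    ring
  · intro a
    rw [← hz]
    congr 1
    rw [eq_neg_iff_add_eq_zero, ← Nat.cast_add, ← mul_add, ZMod.natCast_eq_zero_iff]
    conv_lhs => rw [← hdm]
    refine Nat.mul_dvd_mul_left d ?_
    rw [← ZMod.natCast_eq_zero_iff]
    simp

theorem sum_fiber_dft {N d m : ℕ} [NeZero N] [NeZero m] (h : d * m = N) (hm : m ∣ N)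
    (z : ZMod N → ℂ) (u : ZMod m) :
    (∑ t : ZMod N, if ZMod.castHom hm (ZMod m) t = u then 𝓕 z t else 0) =
      d * 𝓕 (fun x : ZMod m => z ((d * x.val : ℕ) : ZMod N)) u := by
  have hm0 : (m : ℂ) ≠ 0 := NeZero.ne _
  have hd0 : (d : ℂ) ≠ 0 := by
    intro h0
    exact NeZero.ne N (by rw [← h, Nat.cast_eq_zero.mp h0, zero_mul])
  have hN : (N : ℂ) = d * m := by rw [← h, Nat.cast_mul]
  have hchar (t : ZMod N) (x : ZMod m) :
      (ZMod.stdAddChar (ZMod.castHom hm (ZMod m) t * x) : ℂ) =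
        ZMod.stdAddChar (t * ((d * x.val : ℕ) : ZMod N)) := by
    conv_lhs => rw [← ZMod.natCast_zmod_val t, ← ZMod.natCast_zmod_val x, map_natCast]
    conv_rhs => rw [← ZMod.natCast_zmod_val t]
    have h1 := ZMod.stdAddChar_coe (N := m) ((t.val * x.val : ℕ) : ℤ)
    have h2 := ZMod.stdAddChar_coe (N := N) ((t.val * (d * x.val) : ℕ) : ℤ)
    rw [Int.cast_natCast, Nat.cast_mul] at h1 h2
    rw [h1, h2, hN]
    push_cast
    congr 1
    field_simp
  have hinv : (fun u : ZMod m =>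
      ∑ t : ZMod N, if ZMod.castHom hm (ZMod m) t = u then 𝓕 z t else 0) =
      𝓕 (fun x : ZMod m => (d : ℂ) * z ((d * x.val : ℕ) : ZMod N)) := by
    rw [← LinearEquiv.symm_apply_eq]
    funext x
    have hz := congrFun (LinearEquiv.symm_apply_apply (ZMod.dft (N := N) (E := ℂ)) z)
      ((d * x.val : ℕ) : ZMod N)
    rw [ZMod.invDFT_apply] at hz
    rw [ZMod.invDFT_apply, ← hz]
    simp only [smul_eq_mul, Finset.mul_sum, mul_ite, mul_zero]
    rw [Finset.sum_comm]
    refine Finset.sum_congr rfl fun t _ => ?_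
    rw [Finset.sum_ite_eq, if_pos (Finset.mem_univ _), hchar, hN]
    field_simp
  rw [congrFun hinv u]
  exact congrFun (ZMod.dft_const_mul (d : ℂ) _) u

/-- The matrix of the operator `f ↦ (a ↦ ∑ t, F t * f (t * a))` on odd functions, in terms of the
half system `1, …, ⌊(N-1)/2⌋`. -/
def dilationMat (N : ℕ) [NeZero N] (F : ZMod N → ℂ) :
    Matrix (Fin ((N - 1) / 2)) (Fin ((N - 1) / 2)) ℂ :=
  Matrix.of fun i k => ∑ t, if t * halfRep N i = halfRep N k then F t else 0

theorem ZMat_eq (N : ℕ) [NeZero N] (z : ZMod N → ℂ) (hz : ∀ a, z (-a) = -z a) :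
    ZMat N z =
      (2 / N : ℂ) • (dilationMat N (fun t => Complex.I * 𝓕 z t) * sinMat N) := by
  ext i j
  have hF : ∀ t, 𝓕 z (-t) = -𝓕 z t := ZMod.dft_odd_iff.mpr hz
  let Q : ZMod N → ℂ := fun k => ∑ t, if t * halfRep N i = k then 𝓕 z t else 0
  have hQ (k : ZMod N) : Q (-k) = -Q k := by
    simp only [Q]
    rw [← Equiv.sum_comp (Equiv.neg (ZMod N)), ← Finset.sum_neg_distrib]
    refine Finset.sum_congr rfl fun t _ => ?_
    simp only [Equiv.neg_apply, neg_mul, neg_inj, hF]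
    split_ifs <;> simp
  have hQ0 (k : ZMod N) (hk : k = -k) : Q k = 0 := by
    have : Q k = -Q k := by
      conv_lhs => rw [hk, hQ]
    linear_combination this / 2
  have hinv : z (halfRep N i * halfRep N j) =
      (N : ℂ)⁻¹ * ∑ k, ZMod.stdAddChar (k * halfRep N j) * Q k := by
    have h := congrFun (LinearEquiv.symm_apply_apply (ZMod.dft (N := N) (E := ℂ)) z)
      (halfRep N i * halfRep N j)
    rw [ZMod.invDFT_apply] at h
    rw [← h, smul_eq_mul]
    congr 1
    simp only [Q, Finset.mul_sum, mul_ite, mul_zero]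
    rw [Finset.sum_comm]
    refine Finset.sum_congr rfl fun t _ => ?_
    rw [Finset.sum_ite_eq, if_pos (Finset.mem_univ _), smul_eq_mul, mul_assoc]
  have hneg : ∑ k, ZMod.stdAddChar (k * halfRep N j) * Q k =
      -∑ k, ZMod.stdAddChar (-(k * halfRep N j)) * Q k := by
    rw [← Equiv.sum_comp (Equiv.neg (ZMod N)), ← Finset.sum_neg_distrib]
    exact Finset.sum_congr rfl fun k _ => by simp [hQ]
  have hsin : ∑ k, ZMod.stdAddChar (k * halfRep N j) * Q k =
      ∑ k, Complex.I * zmodSin N (k * halfRep N j) * Q k := by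
    have : ∑ k, Complex.I * zmodSin N (k * halfRep N j) * Q k =
        (∑ k, ZMod.stdAddChar (k * halfRep N j) * Q k -
          ∑ k, ZMod.stdAddChar (-(k * halfRep N j)) * Q k) / 2 := by
      rw [← Finset.sum_sub_distrib, Finset.sum_div]
      refine Finset.sum_congr rfl fun k _ => ?_
      rw [← sub_mul, stdAddChar_sub_neg]
      ring
    rw [this]
    linear_combination hneg / 2
  have hhalf := sum_eq_two_mul_sum_halfRep
    (fun k => Complex.I * zmodSin N (k * halfRep N j) * Q k)
    (fun k => by rw [neg_mul, zmodSin_neg, hQ]; ring) (fun k hk => by rw [hQ0 k hk, mul_zero])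
  have hentry : ZMat N z i j = z (halfRep N i * halfRep N j) := by
    simp [ZMat, halfRep]
  rw [hentry, hinv, hsin, hhalf, Matrix.smul_apply, Matrix.mul_apply, smul_eq_mul, ← mul_assoc,
    inv_mul_eq_div]
  congr 1
  refine Finset.sum_congr rfl fun k _ => ?_
  simp only [dilationMat, sinMat, Matrix.of_apply, Q]
  rw [mul_right_comm, Finset.mul_sum]
  simp only [mul_ite, mul_zero]

/-- The index `i` of the residue `i + 1` lies in the block of `gcd (i + 1) N`. -/
def gcdBlock (N : ℕ) (i : Fin ((N - 1) / 2)) : ℕ := Nat.gcd (i + 1) N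

theorem dilationMat_blockTriangular (N : ℕ) [NeZero N] (F : ZMod N → ℂ) :
    (dilationMat N F).BlockTriangular (gcdBlock N) := by
  intro i j hij
  refine Finset.sum_eq_zero fun t _ => if_neg fun h => ?_
  rw [halfRep, halfRep, ← ZMod.natCast_zmod_val t, ← Nat.cast_mul,
    ZMod.natCast_eq_natCast_iff] at h
  have hle : gcdBlock N i ∣ gcdBlock N j := by
    rw [gcdBlock, gcdBlock, ← h.gcd_eq]
    exact Nat.gcd_dvd_gcd_mul_left_left _ _ _
  exact absurd (Nat.le_of_dvd (Nat.gcd_pos_of_pos_left _ (Nat.succ_pos _)) hle) (not_le.mpr hij)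

theorem unit_ne_neg {m : ℕ} (hm : 2 < m) (a : (ZMod m)ˣ) : a ≠ -a := by
  intro ha
  have h2 : (a : ZMod m) * (2 : ℕ) = 0 := by
    have := congrArg Units.val ha
    rw [Units.val_neg, eq_neg_iff_add_eq_zero] at this
    rw [Nat.cast_two, mul_two, this]
  rw [Units.mul_right_eq_zero, ZMod.natCast_eq_zero_iff] at h2
  exact absurd (Nat.le_of_dvd two_pos h2) (not_le.mpr hm)

open scoped Classical in
theorem det_dilationMat_block {N d m : ℕ} [NeZero N] [NeZero m] (h : d * m = N) (hm : m ∣ N)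
    (hm2 : 2 < m) (F : ZMod N → ℂ) (hF : ∀ t, F (-t) = -F t) :
    ((dilationMat N F).toSquareBlock (gcdBlock N) d).det =
      ∏ χ : DirichletCharacter ℂ m, if χ (-1) = -1 then
        (1 / 2) * ∑ u : (ZMod m)ˣ,
          (∑ t : ZMod N, if ZMod.castHom hm (ZMod m) t = (u : ZMod m) then F t else 0) *
            χ (u : ZMod m) else 1 := by
  have hd : 0 < d := Nat.pos_of_ne_zero fun h0 => NeZero.ne N (by rw [← h, h0, zero_mul])
  have hmul (a b : ℕ) : (((d * a : ℕ) : ZMod N) = (d * b : ℕ)) ↔ ((a : ZMod m) = b) := by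
    rw [ZMod.natCast_eq_natCast_iff, ZMod.natCast_eq_natCast_iff, ← h,
      Nat.ModEq.mul_left_cancel_iff' hd.ne']
  have hgcd (a : ℕ) : Nat.gcd (d * a) N = d * Nat.gcd a m := by rw [← h, Nat.gcd_mul_left]
  have hdiv (i : {i // gcdBlock N i = d}) : d * ((i.1 + 1) / d) = i.1 + 1 :=
    Nat.mul_div_cancel' (by
      have := Nat.gcd_dvd_left (i.1 + 1) N
      rwa [show Nat.gcd (i.1 + 1) N = d from i.2] at this)
  have hcop (i : {i // gcdBlock N i = d}) : Nat.Coprime ((i.1 + 1) / d) m := by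
    have hi : Nat.gcd (i.1 + 1) N = d := i.2
    rw [← hdiv i, hgcd] at hi
    exact Nat.eq_of_mul_eq_mul_left hd (by rw [hi, mul_one])
  let r : {i // gcdBlock N i = d} → (ZMod m)ˣ := fun i => ZMod.unitOfCoprime _ (hcop i)
  have hr (i) : ((r i : (ZMod m)ˣ) : ZMod m) = (((i.1 + 1) / d : ℕ) : ZMod m) :=
    ZMod.coe_unitOfCoprime _ _
  have hrep (i : {i // gcdBlock N i = d}) : halfRep N i.1 = (d * ((i.1 + 1) / d) : ℕ) := by
    rw [hdiv, halfRep]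
  have hentry : (dilationMat N F).toSquareBlock (gcdBlock N) d = Matrix.of fun i k =>
      (fun u => ∑ t : ZMod N, if ZMod.castHom hm (ZMod m) t = u then F t else 0)
        ((r k * (r i)⁻¹ : (ZMod m)ˣ) : ZMod m) := by
    ext i k
    simp only [Matrix.toSquareBlock_def, dilationMat, Matrix.of_apply]
    refine Finset.sum_congr rfl fun t _ => if_congr ?_ rfl rfl
    rw [Units.val_mul, Units.eq_mul_inv_iff_mul_eq, hr, hr, hrep, hrep]
    conv_lhs => rw [← ZMod.natCast_zmod_val t]
    conv_rhs => rw [← ZMod.natCast_zmod_val t]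
    rw [map_natCast, ← Nat.cast_mul, ← Nat.cast_mul, mul_left_comm, hmul]
  rw [hentry]
  refine det_oddGroupMatrix r ?_ ?_ ?_ (unit_ne_neg hm2)
    (fun u => ∑ t : ZMod N, if ZMod.castHom hm (ZMod m) t = u then F t else 0) ?_
  · intro i k hik
    have := congrArg Units.val hik
    rw [hr, hr, ← hmul, ← hrep, ← hrep] at this
    exact Subtype.ext (halfRep_injective N this)
  · intro i k hik
    have := congrArg Units.val hik
    rw [Units.val_neg, hr, hr, eq_neg_iff_add_eq_zero, ← Nat.cast_add, ← Nat.cast_zero, ← hmul,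
      mul_add, Nat.cast_add, ← hrep, ← hrep, mul_zero, Nat.cast_zero] at this
    exact halfRep_ne_neg _ _ (eq_neg_of_add_eq_zero_left this)
  · intro a
    obtain ⟨i, hi⟩ := exists_halfRep (a : ZMod m) fun ha => unit_ne_neg hm2 a (Units.ext ha)
    have hi2 := i.2
    have hcopi : Nat.Coprime (i + 1) m := by
      rw [← ZMod.isUnit_iff_coprime]
      rcases hi with hi | hi
      · exact ⟨a, hi⟩
      · exact ⟨-a, by rw [Units.val_neg, hi, neg_neg]; rfl⟩
    have hlt : 2 * (d * (i + 1)) < N := by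
      rw [← h, mul_left_comm]
      exact Nat.mul_lt_mul_of_pos_left (by omega) hd
    have hpos : 0 < d * ((i : ℕ) + 1) := by positivity
    have hsub : d * ((i : ℕ) + 1) - 1 + 1 = d * (i + 1) := Nat.sub_add_cancel hpos
    let j : {i // gcdBlock N i = d} := ⟨⟨d * (i + 1) - 1, by omega⟩, by
      simp only [gcdBlock]
      rw [hsub, hgcd, hcopi, mul_one]⟩
    have hj : ((r j : (ZMod m)ˣ) : ZMod m) = halfRep m i := by
      rw [hr, halfRep]
      simp only [j]
      rw [hsub, Nat.mul_div_cancel_left _ hd]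
    refine ⟨j, ?_⟩
    simpa only [Units.ext_iff, Units.val_neg, hj] using hi
  · intro u
    rw [← Equiv.sum_comp (Equiv.neg (ZMod N)), ← Finset.sum_neg_distrib]
    refine Finset.sum_congr rfl fun t _ => ?_
    simp only [Equiv.neg_apply, map_neg, neg_inj, hF]
    split_ifs <;> simp

open scoped Classical in
theorem charProdOdd_eq_prod (c : ℂ) (n : ℕ) [NeZero n] (g : ZMod n → ℂ) :
    charProdOdd c n g = ∏ χ : DirichletCharacter ℂ n, if χ (-1) = -1 then
      c * ∑ t : (ZMod n)ˣ, g (t : ZMod n) * χ (t : ZMod n) else 1 := by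
  cases n with
  | zero => exact absurd rfl (NeZero.ne 0)
  | succ n => rfl

theorem image_gcdBlock (N : ℕ) [NeZero N] :
    Finset.univ.image (gcdBlock N) = N.divisors.filter fun d => 2 < N / d := by
  ext d
  simp only [Finset.mem_image, Finset.mem_univ, true_and, Finset.mem_filter, Nat.mem_divisors]
  constructor
  · rintro ⟨i, rfl⟩
    have hi := i.2
    have hdvd : gcdBlock N i ∣ N := Nat.gcd_dvd_right _ _
    have hle : gcdBlock N i ≤ i + 1 := Nat.le_of_dvd (Nat.succ_pos _) (Nat.gcd_dvd_left _ _)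
    refine ⟨⟨hdvd, NeZero.ne N⟩, ?_⟩
    obtain ⟨m, hm⟩ := hdvd
    have hpos : 0 < gcdBlock N i := Nat.gcd_pos_of_pos_left _ (Nat.succ_pos _)
    generalize gcdBlock N i = d at *
    rw [hm, Nat.mul_div_cancel_left _ hpos]
    have : d * 2 < d * m := by omega
    exact Nat.lt_of_mul_lt_mul_left this
  · rintro ⟨⟨⟨m, hm⟩, hN⟩, h2⟩
    have hpos : 0 < d := Nat.pos_of_ne_zero fun h => hN (by rw [hm, h, zero_mul])
    rw [hm, Nat.mul_div_cancel_left _ hpos] at h2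
    have : d * 2 < d * m := Nat.mul_lt_mul_of_pos_left h2 hpos
    refine ⟨⟨d - 1, by omega⟩, ?_⟩
    simp only [gcdBlock]
    rw [Nat.sub_add_cancel hpos, Nat.gcd_eq_left ⟨m, hm⟩]

theorem det_dilationMat (N : ℕ) [NeZero N] (z : ZMod N → ℂ) (hz : ∀ a, z (-a) = -z a) :
    (dilationMat N fun t => Complex.I * 𝓕 z t).det =
      ∏ d ∈ N.divisors.filter (fun d => 2 < N / d),
        charProdOdd (d : ℂ) (N / d) (fun t => zhat N d z t) := by
  have hF : ∀ t, 𝓕 z (-t) = -𝓕 z t := ZMod.dft_odd_iff.mpr hz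
  rw [(dilationMat_blockTriangular N _).det, image_gcdBlock]
  refine Finset.prod_congr rfl fun d hd => ?_
  obtain ⟨hd, h2⟩ := Finset.mem_filter.mp hd
  have hdvd := Nat.dvd_of_mem_divisors hd
  have : NeZero (N / d) := ⟨by omega⟩
  rw [det_dilationMat_block (Nat.mul_div_cancel' hdvd) (Nat.div_dvd_of_dvd hdvd) h2 _
    fun t => by rw [hF, mul_neg], charProdOdd_eq_prod]
  refine Finset.prod_congr rfl fun χ _ => if_congr Iff.rfl ?_ rfl
  rw [Finset.mul_sum, Finset.mul_sum]
  refine Finset.sum_congr rfl fun u _ => ?_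
  have h1 := sum_fiber_dft (Nat.mul_div_cancel' hdvd) (Nat.div_dvd_of_dvd hdvd) z (u : ZMod (N / d))
  have h3 := I_mul_dft_section hdvd z hz (u : ZMod (N / d))
  have h4 : (∑ t : ZMod N, if ZMod.castHom (Nat.div_dvd_of_dvd hdvd) (ZMod (N / d)) t = u
      then Complex.I * 𝓕 z t else 0) = 2 * (d * zhat N d z u) := by
    rw [mul_left_comm, ← h3, mul_left_comm, ← h1, Finset.mul_sum]
    simp only [mul_ite, mul_zero]
  rw [h4]
  ring

end

/-- `det(Z_N) = (−1)^{N⁻(N⁻−1)/2} · N^{−N⁻/2} ·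
∏_{d ∣ N, N/d > 2} ∏_{χ odd mod N_d} (d · Σ_{t ∈ (ℤ/N_dℤ)ˣ} ẑ_d(t)·χ(t))`,
where `N⁻ = ⌊(N−1)/2⌋`. -/
theorem det_ZMat (N : ℕ) (hN : 2 ≤ N) (z : ZMod N → ℂ)
    (hz : ∀ a : ZMod N, z (-a) = -z a) :
    (ZMat N z).det =
      (-1 : ℂ) ^ ((N - 1) / 2 * ((N - 1) / 2 - 1) / 2) *
        ((Real.sqrt N : ℂ)) ^ (-(((N - 1) / 2 : ℕ) : ℤ)) *
        ∏ d ∈ N.divisors.filter (fun d => 2 < N / d),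
          charProdOdd (d : ℂ) (N / d) (fun t => zhat N d z t) := by
  have : NeZero N := ⟨by omega⟩
  rw [ZMat_eq N z hz, Matrix.det_smul, Matrix.det_mul, det_sinMat, det_dilationMat N z hz,
    Fintype.card_fin, zpow_neg, zpow_natCast, ← inv_pow]
  have hN0 : (Real.sqrt N : ℂ) ≠ 0 := by
    rw [Ne, Complex.ofReal_eq_zero, Real.sqrt_eq_zero']
    simp only [not_le, Nat.cast_pos]
    omega
  have hsq : (N : ℂ) = (Real.sqrt N : ℂ) * (Real.sqrt N : ℂ) := by
    rw [← Complex.ofReal_mul, Real.mul_self_sqrt (Nat.cast_nonneg N)]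
    simp
  have hscale : (2 / N : ℂ) * ((Real.sqrt N : ℂ) / 2) = (Real.sqrt N : ℂ)⁻¹ := by
    rw [hsq]
    field_simp
  rw [← hscale, mul_pow]
  ring
end
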